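/- arXiv:funct-an/9712002 — 2 statements merged into one kernel-verified Lean document; each statement's English description precedes it below -/
import Mathlib

section
/- Let H be a complex Hilbert space and let A ⊆ B(H) be a separable unital C*-subalgebra such that the inclusion A ↪ B(H) is nuclear, meaning: for every finite subset F ⊆ A and every η > 0 there exist k ≥ 1 and unital completely positive maps S : A → M_k(ℂ) and T : M_k(ℂ) → B(H) with ‖T(S(a)) − a‖ < η for all a ∈ F. Let E ⊆ A be a finite-dimensional operator system and let ε > 0. Then for every δ with 0 ≤ δ < ε there exists an integer n ≥ 1 such that the following holds: whenever B₁ and B₂ are separable unital C*-algebras with B₂ nuclear, and V : E → B₁ and W : E → B₂ are unital completely positive maps such that V is injective and ‖X‖ ≤ (1 + δ)·‖X_V‖ for every n×n matrix X over A with all entries in E (X_V denoting the entrywise application of V), then there is a unital completely positive map T : B₁ → B₂ such that sup{ ‖T(V(x)) − W(x)‖ : x ∈ E, ‖x‖ ≤ 1 } < ε. -/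
/-- A square matrix over a ∗-ring is positive if it is of the form `Yᴴ·Y`.
(In a C*-algebra this is the usual notion of positivity.) -/
def MatPos {R : Type*} [NonUnitalSemiring R] [StarRing R] {k : ℕ}
    (X : Matrix (Fin k) (Fin k) R) : Prop :=
  ∃ Y : Matrix (Fin k) (Fin k) R, X = star Y * Y

/-- A linear map between C*-algebras is completely positive if all of its entrywise
amplifications to matrix algebras map positive matrices to positive matrices. -/
def IsCP {A B : Type*} [NonUnitalSemiring A] [StarRing A] [Module ℂ A]
    [NonUnitalSemiring B] [StarRing B] [Module ℂ B] (T : A →ₗ[ℂ] B) : Prop :=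
  ∀ (k : ℕ) (X : Matrix (Fin k) (Fin k) A), MatPos X → MatPos (X.map fun x => T x)

/-- The canonical C*-norm of a square matrix over a unital C*-algebra: the square root of
the spectral radius of `X*·X` (computed in the matrix algebra). -/
noncomputable def matNorm {A : Type*} [NormedRing A] [StarRing A] [NormedAlgebra ℂ A]
    {k : ℕ} (X : Matrix (Fin k) (Fin k) A) : ℝ :=
  Real.sqrt (spectralRadius ℂ (star X * X)).toReal

section CStar

theorem nonneg_iff_exists_star_mul_self {C : Type*} [CStarAlgebra C] [PartialOrder C]
    [StarOrderedRing C] {a : C} : 0 ≤ a ↔ ∃ b, a = star b * b :=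
  CStarAlgebra.nonneg_iff_eq_star_mul_self

theorem smul_one_add_nonneg {C : Type*} [CStarAlgebra C] [PartialOrder C] [StarOrderedRing C]
    {a : C} (ha : IsSelfAdjoint a) {c : ℝ} (hc : ‖a‖ ≤ c) : 0 ≤ (c : ℂ) • (1 : C) + a := by
  have h1 := ha.neg_algebraMap_norm_le_self
  have h2 : algebraMap ℝ C ‖a‖ ≤ algebraMap ℝ C c := algebraMap_mono C hc
  rw [Complex.coe_smul, ← Algebra.algebraMap_eq_smul_one, ← neg_le_iff_add_nonneg']
  exact (neg_le_neg h2).trans h1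

theorem norm_le_of_smul_one_add_sub_nonneg {C : Type*} [CStarAlgebra C] [PartialOrder C]
    [StarOrderedRing C] {a : C} (ha : IsSelfAdjoint a) {c : ℝ} (hc : 0 ≤ c)
    (h1 : 0 ≤ (c : ℂ) • (1 : C) + a) (h2 : 0 ≤ (c : ℂ) • (1 : C) - a) : ‖a‖ ≤ c := by
  have hcomm : Commute ((c : ℂ) • (1 : C) + a) ((c : ℂ) • (1 : C) - a) := by
    refine Commute.add_left ?_ ?_ <;> refine Commute.sub_right ?_ ?_ <;>
      simp [Commute.smul_left, Commute.smul_right, Commute.refl]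
  have h3 := hcomm.mul_nonneg h1 h2
  have h4 : star a * a ≤ algebraMap ℝ C (c ^ 2) := by
    rw [← sub_nonneg, ha.star_eq]
    convert h3 using 1
    simp only [Complex.coe_smul, Algebra.algebraMap_eq_smul_one, mul_sub, add_mul, smul_mul_assoc,
      one_mul, mul_smul_comm, mul_one, smul_add, smul_smul, sq]
    abel
  rw [← CStarAlgebra.norm_le_iff_le_algebraMap _ (by positivity) (star_mul_self_nonneg a),
    CStarRing.norm_star_mul_self, ← sq] at h4
  exact (pow_le_pow_iff_left₀ (norm_nonneg a) hc two_ne_zero).1 h4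

variable {B : Type*} [CStarAlgebra B]

open CStarMatrix in
theorem matPos_iff_nonneg [PartialOrder B] [StarOrderedRing B] {k : ℕ}
    {X : Matrix (Fin k) (Fin k) B} :
    MatPos X ↔ (0 : CStarMatrix (Fin k) (Fin k) B) ≤ ofMatrix X :=
  (nonneg_iff_exists_star_mul_self (a := ofMatrix X)).symm

theorem MatPos.add {k : ℕ} {X Y : Matrix (Fin k) (Fin k) B} (hX : MatPos X) (hY : MatPos Y) :
    MatPos (X + Y) := by
  let _ := CStarAlgebra.spectralOrder B
  let _ := CStarAlgebra.spectralOrderedRing B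
  exact matPos_iff_nonneg.2 (add_nonneg (matPos_iff_nonneg.1 hX) (matPos_iff_nonneg.1 hY))

theorem matPos_sum {k : ℕ} {ι : Type*} (s : Finset ι) (X : ι → Matrix (Fin k) (Fin k) B)
    (hX : ∀ i ∈ s, MatPos (X i)) : MatPos (∑ i ∈ s, X i) :=
  Finset.sum_induction X MatPos (fun _ _ => MatPos.add) ⟨0, by simp⟩ hX

theorem MatPos.conj {k : ℕ} {R : Type*} [NonUnitalSemiring R] [StarRing R]
    {X : Matrix (Fin k) (Fin k) R} (hX : MatPos X)
    (K : Matrix (Fin k) (Fin k) R) : MatPos (star K * X * K) := by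
  obtain ⟨Y, rfl⟩ := hX
  exact ⟨Y * K, by simp [mul_assoc]⟩

theorem MatPos.isSelfAdjoint {k : ℕ} {R : Type*} [NonUnitalSemiring R] [StarRing R]
    {X : Matrix (Fin k) (Fin k) R} (hX : MatPos X) : IsSelfAdjoint X := by
  obtain ⟨Y, rfl⟩ := hX
  exact IsSelfAdjoint.star_mul_self Y

theorem MatPos.map_starHom {R S : Type*} [NonUnitalSemiring R] [StarRing R] [NonUnitalSemiring S]
    [StarRing S] {F : Type*} [FunLike F R S] [NonUnitalRingHomClass F R S] [StarHomClass F R S]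
    (φ : F) {k : ℕ} {X : Matrix (Fin k) (Fin k) R} (hX : MatPos X) :
    MatPos (X.map φ) := by
  obtain ⟨Y, rfl⟩ := hX
  refine ⟨Y.map φ, ?_⟩
  ext i j
  simp [Matrix.mul_apply, Matrix.star_apply, map_star]

/-- The Gram matrix of finitely many row vectors over a C*-algebra is positive. -/
theorem matPos_gram {k m : ℕ} (v : Fin m → Fin k → B) :
    MatPos (Matrix.of fun i j => ∑ p, star (v p i) * v p j) := by
  cases k with
  | zero => exact ⟨0, Subsingleton.elim _ _⟩
  | succ k =>
    have h : (Matrix.of fun i j => ∑ p, star (v p i) * v p j)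
        = ∑ p, (Matrix.of fun i j => star (v p i) * v p j) := by
      ext i j
      simp [Matrix.sum_apply]
    rw [h]
    refine matPos_sum _ _ fun p _ => ⟨Matrix.of fun i j => if i = 0 then v p j else 0, ?_⟩
    ext i j
    simp [Matrix.mul_apply, Matrix.star_apply]

open CStarMatrix in
theorem matNorm_eq_norm [PartialOrder B] [StarOrderedRing B] {k : ℕ}
    (X : Matrix (Fin k) (Fin k) B) : matNorm X = ‖ofMatrix X‖ := by
  have h1 : spectralRadius ℂ (star X * X)
      = spectralRadius ℂ (star (ofMatrix X) * ofMatrix X) := rfl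
  rw [matNorm, h1, (IsSelfAdjoint.star_mul_self (ofMatrix X)).spectralRadius_eq_nnnorm]
  simp [CStarRing.norm_star_mul_self]

theorem matNorm_nonneg {R : Type*} [NormedRing R] [StarRing R] [NormedAlgebra ℂ R] {k : ℕ}
    (X : Matrix (Fin k) (Fin k) R) : 0 ≤ matNorm X :=
  Real.sqrt_nonneg _

theorem matPos_smul_one_add {k : ℕ} {X : Matrix (Fin k) (Fin k) B} (hX : IsSelfAdjoint X)
    {c : ℝ} (hc : matNorm X ≤ c) : MatPos ((c : ℂ) • 1 + X) := by
  let _ := CStarAlgebra.spectralOrder B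
  let _ := CStarAlgebra.spectralOrderedRing B
  rw [matNorm_eq_norm] at hc
  have hX' : IsSelfAdjoint (CStarMatrix.ofMatrix X) := hX
  exact matPos_iff_nonneg.2 (smul_one_add_nonneg hX' hc)

theorem exists_matPos_smul_one_add {k : ℕ} {X : Matrix (Fin k) (Fin k) B} (hX : IsSelfAdjoint X) :
    ∃ c : ℝ, MatPos ((c : ℂ) • 1 + X) :=
  ⟨_, matPos_smul_one_add hX le_rfl⟩

theorem matNorm_le_of_matPos {k : ℕ} {X : Matrix (Fin k) (Fin k) B} (hX : IsSelfAdjoint X)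
    {c : ℝ} (hc : 0 ≤ c) (h1 : MatPos ((c : ℂ) • 1 + X)) (h2 : MatPos ((c : ℂ) • 1 - X)) :
    matNorm X ≤ c := by
  let _ := CStarAlgebra.spectralOrder B
  let _ := CStarAlgebra.spectralOrderedRing B
  rw [matNorm_eq_norm]
  have hX' : IsSelfAdjoint (CStarMatrix.ofMatrix X) := hX
  exact norm_le_of_smul_one_add_sub_nonneg hX' hc (matPos_iff_nonneg.1 h1) (matPos_iff_nonneg.1 h2)

theorem MatPos.smul {k : ℕ} {X : Matrix (Fin k) (Fin k) B} (hX : MatPos X) {r : ℝ} (hr : 0 ≤ r) :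
    MatPos ((r : ℂ) • X) := by
  obtain ⟨Y, rfl⟩ := hX
  refine ⟨((√r : ℝ) : ℂ) • Y, ?_⟩
  rw [star_smul, smul_mul_smul_comm]
  congr 1
  simp [← Complex.ofReal_mul, Real.mul_self_sqrt hr]

theorem matNorm_map_of_injective {C : Type*} [CStarAlgebra C] (φ : B →⋆ₙₐ[ℂ] C)
    (hφ : Function.Injective φ) {k : ℕ} (X : Matrix (Fin k) (Fin k) B) :
    matNorm (X.map φ) = matNorm X := by
  let _ := CStarAlgebra.spectralOrder B
  let _ := CStarAlgebra.spectralOrderedRing B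
  let _ := CStarAlgebra.spectralOrder C
  let _ := CStarAlgebra.spectralOrderedRing C
  rw [matNorm_eq_norm, matNorm_eq_norm]
  exact NonUnitalStarAlgHom.norm_map (CStarMatrix.mapₙₐ φ)
    (fun _ _ h => CStarMatrix.map_injective hφ h) (CStarMatrix.ofMatrix X)

end CStar

section Contractive

variable {B : Type*} [CStarAlgebra B]

theorem exists_star_mul_self_eq_smul_one_sub {a : B} {s : ℝ} (hs : ‖a‖ ≤ s) :
    ∃ z : B, star z * z = ((s ^ 2 : ℝ) : ℂ) • 1 - star a * a := by
  let _ := CStarAlgebra.spectralOrder B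
  let _ := CStarAlgebra.spectralOrderedRing B
  have h : ‖-(star a * a)‖ ≤ s ^ 2 := by
    rw [norm_neg, CStarRing.norm_star_mul_self, ← sq]
    exact pow_le_pow_left₀ (norm_nonneg a) hs 2
  obtain ⟨z, hz⟩ := nonneg_iff_exists_star_mul_self.1
    (smul_one_add_nonneg (IsSelfAdjoint.star_mul_self a).neg h)
  exact ⟨z, by rw [← hz, sub_eq_add_neg]⟩

theorem matPos_of_norm_le {a : B} {s : ℝ} (hs : 0 < s) (ha : ‖a‖ ≤ s) :
    MatPos !![(s : ℂ) • (1 : B), a; star a, (s : ℂ) • 1] := by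
  obtain ⟨z, hz⟩ := exists_star_mul_self_eq_smul_one_sub ha
  have h1 : ((√s : ℝ) : ℂ) * ((√s : ℝ) : ℂ) = s := by
    rw [← Complex.ofReal_mul, Real.mul_self_sqrt hs.le]
  have h0 : ((√s : ℝ) : ℂ) ≠ 0 := by
    exact_mod_cast (Real.sqrt_pos.2 hs).ne'
  have h2 : ((√s : ℝ) : ℂ)⁻¹ * ((√s : ℝ) : ℂ)⁻¹ * ((s ^ 2 : ℝ) : ℂ) = s := by
    push_cast
    rw [← h1]
    field_simp
  refine ⟨!![((√s : ℝ) : ℂ) • (1 : B), ((√s : ℝ) : ℂ)⁻¹ • a; 0, ((√s : ℝ) : ℂ)⁻¹ • z], ?_⟩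
  ext i j
  fin_cases i <;> fin_cases j
  · simp [Matrix.mul_apply, Matrix.star_apply, smul_smul, Real.mul_self_sqrt hs.le]
  · simp [Matrix.mul_apply, Matrix.star_apply, smul_smul, h0, -Complex.coe_smul]
  · simp [Matrix.mul_apply, Matrix.star_apply, smul_smul, h0, -Complex.coe_smul]
  · have h3 : (s : ℂ) • (1 : B) = (((√s : ℝ) : ℂ)⁻¹ * ((√s : ℝ) : ℂ)⁻¹) • (star a * a)
        + (((√s : ℝ) : ℂ)⁻¹ * ((√s : ℝ) : ℂ)⁻¹) • (star z * z) := by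
      rw [hz, ← smul_add, add_sub_cancel, smul_smul, h2]
    simpa [Matrix.mul_apply, Matrix.star_apply, smul_smul] using h3

theorem MatPos.two_by_two {b b' : B} {s : ℝ} (hs : 0 ≤ s)
    (h : MatPos !![(s : ℂ) • (1 : B), b; b', (s : ℂ) • 1]) : b' = star b ∧ ‖b‖ ≤ s := by
  let _ := CStarAlgebra.spectralOrder B
  let _ := CStarAlgebra.spectralOrderedRing B
  have hstar : b' = star b := by
    have := congrFun (congrFun h.isSelfAdjoint.star_eq 1) 0
    simpa [Matrix.star_apply] using this.symm
  refine ⟨hstar, le_of_forall_gt_imp_ge_of_dense fun t ht => ?_⟩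
  have ht0 : 0 < t := hs.trans_lt ht
  obtain ⟨Y, hY⟩ := h
  have e00 := congrFun (congrFun hY 0) 0
  have e01 := congrFun (congrFun hY 0) 1
  have e10 := congrFun (congrFun hY 1) 0
  have e11 := congrFun (congrFun hY 1) 1
  simp only [Matrix.mul_apply, Matrix.star_apply, Fin.sum_univ_two, Matrix.of_apply,
    Matrix.cons_val', Matrix.cons_val_zero, Matrix.cons_val_one, Matrix.cons_val_fin_one]
    at e00 e01 e10 e11
  have key : 0 ≤ star (Y 0 0 * b - (t : ℂ) • Y 0 1) * (Y 0 0 * b - (t : ℂ) • Y 0 1)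
      + star (Y 1 0 * b - (t : ℂ) • Y 1 1) * (Y 1 0 * b - (t : ℂ) • Y 1 1) :=
    add_nonneg (star_mul_self_nonneg _) (star_mul_self_nonneg _)
  have expand : star (Y 0 0 * b - (t : ℂ) • Y 0 1) * (Y 0 0 * b - (t : ℂ) • Y 0 1)
      + star (Y 1 0 * b - (t : ℂ) • Y 1 1) * (Y 1 0 * b - (t : ℂ) • Y 1 1)
      = star b * (star (Y 0 0) * Y 0 0 + star (Y 1 0) * Y 1 0) * b
        - (t : ℂ) • (star b * (star (Y 0 0) * Y 0 1 + star (Y 1 0) * Y 1 1))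
        - (t : ℂ) • ((star (Y 0 1) * Y 0 0 + star (Y 1 1) * Y 1 0) * b)
        + (t : ℂ) • (t : ℂ) • (star (Y 0 1) * Y 0 1 + star (Y 1 1) * Y 1 1) := by
    simp only [star_sub, star_mul, star_smul, sub_mul, mul_sub, add_mul, mul_add, smul_mul_assoc,
      mul_smul_comm, smul_add, smul_sub, mul_assoc, RCLike.star_def, Complex.conj_ofReal]
    abel
  rw [expand, ← e00, ← e01, ← e10, ← e11, hstar] at key
  have h2 : star b * b ≤ algebraMap ℝ B (t ^ 2 * s / (2 * t - s)) := by
    have hpos : 0 < 2 * t - s := by linarith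
    have h3 : 0 ≤ (2 * t - s)⁻¹ • (star b * ((s : ℂ) • (1 : B)) * b - (t : ℂ) • (star b * b)
        - (t : ℂ) • (star b * b) + (t : ℂ) • (t : ℂ) • (s : ℂ) • (1 : B)) :=
      smul_nonneg (inv_nonneg.2 hpos.le) key
    rw [← sub_nonneg]
    convert h3 using 1
    simp only [Complex.coe_smul, Algebra.algebraMap_eq_smul_one, mul_smul_comm, mul_one,
      smul_mul_assoc, smul_smul]
    match_scalars <;> field_simp
    ring
  rw [← CStarAlgebra.norm_le_iff_le_algebraMap _ _ (star_mul_self_nonneg b),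
    CStarRing.norm_star_mul_self, ← sq] at h2
  · refine (pow_le_pow_iff_left₀ (norm_nonneg b) ht0.le two_ne_zero).1 (h2.trans ?_)
    rw [div_le_iff₀ (by linarith)]
    nlinarith [sq_nonneg t]
  · exact div_nonneg (by positivity) (by linarith)

/-- A two-positive map on a (concretely represented) operator system which sends the unit to a
scalar `r` is hermitian and bounded by `r`. -/
theorem two_positive_bound {C G : Type*} [CStarAlgebra C] [AddCommGroup G] [Module ℂ G]
    {J : G →ₗ[ℂ] B} {L : G →ₗ[ℂ] C} {u : G} {r : ℝ} (hr : 0 ≤ r) (hJ : J u = 1)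
    (hL : L u = (r : ℂ) • 1)
    (h : ∀ X : Matrix (Fin 2) (Fin 2) G, MatPos (X.map J) → MatPos (X.map L))
    {x y : G} (hxy : J y = star (J x)) : L y = star (L x) ∧ ‖L x‖ ≤ r * ‖J x‖ := by
  have key : ∀ s : ℝ, ‖J x‖ < s → L y = star (L x) ∧ ‖L x‖ ≤ s * r := by
    intro s hs
    have hs0 : 0 < s := (norm_nonneg _).trans_lt hs
    have h1 : (!![(s : ℂ) • u, x; y, (s : ℂ) • u]).map J
        = !![(s : ℂ) • (1 : B), J x; star (J x), (s : ℂ) • 1] := by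
      ext i j
      fin_cases i <;> fin_cases j <;> simp [hJ, hxy]
    have h2 : (!![(s : ℂ) • u, x; y, (s : ℂ) • u]).map L
        = !![((s * r : ℝ) : ℂ) • (1 : C), L x; L y, ((s * r : ℝ) : ℂ) • 1] := by
      ext i j
      fin_cases i <;> fin_cases j <;> simp [hL, smul_smul, -Complex.coe_smul]
    have h3 := h _ (h1 ▸ matPos_of_norm_le hs0 hs.le)
    rw [h2] at h3
    exact h3.two_by_two (by positivity)
  refine ⟨(key (‖J x‖ + 1) (by linarith)).1, le_of_forall_pos_le_add fun t ht => ?_⟩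
  have h1 : 0 < r + 1 := by linarith
  have h2 := (key (‖J x‖ + t / (r + 1)) (by have := div_pos ht h1; linarith)).2
  have h3 : t / (r + 1) * r ≤ t := by
    rw [div_mul_eq_mul_div, div_le_iff₀ h1]
    nlinarith
  linarith

theorem IsCP.norm_le {C : Type*} [CStarAlgebra C] {L : B →ₗ[ℂ] C} (h : IsCP L) {r : ℝ}
    (hr : 0 ≤ r) (h1 : L 1 = (r : ℂ) • 1) (x : B) : ‖L x‖ ≤ r * ‖x‖ :=
  (two_positive_bound (J := LinearMap.id) (u := 1) hr rfl h1
    (fun X hX => h 2 X (by simpa using hX)) (y := star x) rfl).2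

theorem IsCP.comp {A B C : Type*} [NonUnitalSemiring A] [StarRing A] [Module ℂ A]
    [NonUnitalSemiring B] [StarRing B] [Module ℂ B] [NonUnitalSemiring C] [StarRing C] [Module ℂ C]
    {T : B →ₗ[ℂ] C} {S : A →ₗ[ℂ] B} (hT : IsCP T) (hS : IsCP S) : IsCP (T ∘ₗ S) :=
  fun k X hX => by simpa [Matrix.map_map] using! hT k _ (hS k X hX)

end Contractive

section Extension

/-- The linear functional on `n × n` matrices attached to a linear map into `n × n` complex
matrices. -/
noncomputable def matrixPairing {G : Type*} [AddCommGroup G] [Module ℂ G] {n : ℕ}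
    (Ψ : G →ₗ[ℂ] Matrix (Fin n) (Fin n) ℂ) : Matrix (Fin n) (Fin n) G →ₗ[ℂ] ℂ :=
  ∑ i, ∑ j, Matrix.entryLinearMap ℂ ℂ i j ∘ₗ Ψ ∘ₗ Matrix.entryLinearMap ℂ G i j

theorem matrixPairing_apply {G : Type*} [AddCommGroup G] [Module ℂ G] {n : ℕ}
    (Ψ : G →ₗ[ℂ] Matrix (Fin n) (Fin n) ℂ) (X : Matrix (Fin n) (Fin n) G) :
    matrixPairing Ψ X = ∑ i, ∑ j, Ψ (X i j) i j := by
  simp [matrixPairing]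

theorem MatPos.re_sum_nonneg {n : ℕ} {Z : Matrix (Fin n) (Fin n) (Matrix (Fin n) (Fin n) ℂ)}
    (hZ : MatPos Z) : 0 ≤ (∑ i, ∑ j, Z i j i j).re := by
  obtain ⟨Y, rfl⟩ := hZ
  have h : ∑ i, ∑ j, (star Y * Y) i j i j
      = ∑ p, ∑ q, star (∑ i, Y p i q i) * ∑ j, Y p j q j := by
    have h1 : ∑ i, ∑ j, (star Y * Y) i j i j
        = ∑ i, ∑ j, ∑ p, ∑ q, star (Y p i q i) * Y p j q j := by
      simp only [Matrix.mul_apply, Matrix.star_apply, Matrix.sum_apply]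
    rw [h1]
    simp only [star_sum, Finset.sum_mul_sum]
    exact (Finset.sum_congr rfl fun i _ => Finset.sum_comm).trans (Finset.sum_comm.trans
      (Finset.sum_congr rfl fun p _ =>
        (Finset.sum_congr rfl fun i _ => Finset.sum_comm).trans Finset.sum_comm))
  rw [h, Complex.re_sum]
  refine Finset.sum_nonneg fun p _ => ?_
  rw [Complex.re_sum]
  refine Finset.sum_nonneg fun q _ => ?_
  rw [RCLike.star_def, ← Complex.normSq_eq_conj_mul_self, Complex.ofReal_re]
  exact Complex.normSq_nonneg _

variable {B : Type*} [CStarAlgebra B]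

/-- The real cone of matrices with positive real part. -/
def rePosCone (B : Type*) [CStarAlgebra B] (n : ℕ) :
    PointedCone ℝ (Matrix (Fin n) (Fin n) B) where
  carrier := {X | MatPos (X + star X)}
  zero_mem' := ⟨0, by simp⟩
  add_mem' {X Y} hX hY := by
    have := MatPos.add hX hY
    change MatPos (X + Y + star (X + Y))
    rw [star_add]
    convert this using 1
    abel
  smul_mem' c X hX := by
    have := MatPos.smul hX c.2
    have h : star (c • X) = c • star X := by
      change star ((c : ℝ) • X) = (c : ℝ) • star X
      rw [star_smul, star_trivial]
    change MatPos (c • X + star (c • X))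
    rw [h, ← smul_add]
    exact this

theorem mem_rePosCone {n : ℕ} {X : Matrix (Fin n) (Fin n) B} :
    X ∈ rePosCone B n ↔ MatPos (X + star X) := Iff.rfl

theorem MatPos.mem_rePosCone {n : ℕ} {X : Matrix (Fin n) (Fin n) B} (hX : MatPos X) :
    X ∈ rePosCone B n := by
  rw [_root_.mem_rePosCone, hX.isSelfAdjoint.star_eq]
  exact hX.add hX

section Functional

variable {n : ℕ} {g : Module.Dual ℝ (Matrix (Fin n) (Fin n) B)}

theorem apply_eq_zero_of_skew (hg : ∀ X ∈ rePosCone B n, 0 ≤ g X)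
    {X : Matrix (Fin n) (Fin n) B} (hX : star X = -X) : g X = 0 := by
  have h1 := hg X (mem_rePosCone.2 ⟨0, by simp [hX]⟩)
  have h2 := hg (-X) (mem_rePosCone.2 ⟨0, by simp [hX]⟩)
  rw [map_neg] at h2
  linarith

theorem extendRCLike_star (hg : ∀ X ∈ rePosCone B n, 0 ≤ g X) (X : Matrix (Fin n) (Fin n) B) :
    g.extendRCLike (𝕜 := ℂ) (star X) = star (g.extendRCLike (𝕜 := ℂ) X) := by
  have h1 := apply_eq_zero_of_skew hg (X := X - star X) (by simp)
  have h2 := apply_eq_zero_of_skew hg (X := Complex.I • X + Complex.I • star X)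
    (by simp [star_smul, add_comm])
  rw [map_sub] at h1
  rw [map_add] at h2
  simp only [Module.Dual.extendRCLike_apply]
  apply Complex.ext
  · simp
    linarith
  · simp
    linarith

open ComplexOrder in
theorem extendRCLike_nonneg (hg : ∀ X ∈ rePosCone B n, 0 ≤ g X) {X : Matrix (Fin n) (Fin n) B}
    (hX : MatPos X) : 0 ≤ g.extendRCLike (𝕜 := ℂ) X := by
  have h1 := hg X hX.mem_rePosCone
  have h2 := apply_eq_zero_of_skew hg (X := Complex.I • X)
    (by simp [star_smul, hX.isSelfAdjoint.star_eq])
  rw [Module.Dual.extendRCLike_apply, RCLike.I_to_complex, h2]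
  simpa using h1

end Functional

/-- The linear map into matrices attached to a linear functional on matrices. -/
noncomputable def ofMatrixFunctional {n : ℕ} (s : Matrix (Fin n) (Fin n) B →ₗ[ℂ] ℂ) :
    B →ₗ[ℂ] Matrix (Fin n) (Fin n) ℂ where
  toFun a := Matrix.of fun i j => s (Matrix.single i j a)
  map_add' a b := by ext i j; simp [Matrix.single_add]
  map_smul' c a := by ext i j; simp [← Matrix.smul_single]

theorem ofMatrixFunctional_apply {n : ℕ} (s : Matrix (Fin n) (Fin n) B →ₗ[ℂ] ℂ) (a : B)
    (i j : Fin n) : ofMatrixFunctional s a i j = s (Matrix.single i j a) := rfl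

open scoped MatrixOrder ComplexOrder Matrix.Norms.L2Operator in
theorem Matrix.PosSemidef.exists_eq_conjTranspose_mul_self {m : Type*} [Fintype m]
    [DecidableEq m] {N : Matrix m m ℂ} (hN : N.PosSemidef) :
    ∃ R : Matrix m m ℂ, N = R.conjTranspose * R :=
  CStarAlgebra.nonneg_iff_eq_star_mul_self.mp hN.nonneg

open ComplexOrder in
theorem isCP_ofMatrixFunctional {n : ℕ} {s : Matrix (Fin n) (Fin n) B →ₗ[ℂ] ℂ}
    (hstar : ∀ X, s (star X) = star (s X)) (hpos : ∀ X, MatPos X → 0 ≤ s X) :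
    IsCP (ofMatrixFunctional s) := by
  intro k X hX
  let N : Matrix (Fin k × Fin n) (Fin k × Fin n) ℂ :=
    Matrix.of fun a b => ofMatrixFunctional s (X a.1 b.1) a.2 b.2
  have hN : N.PosSemidef := by
    refine Matrix.PosSemidef.of_dotProduct_mulVec_nonneg ?_ fun ξ => ?_
    · ext ⟨p, i⟩ ⟨q, j⟩
      have h1 : X p q = star (X q p) := by
        conv_lhs => rw [← hX.isSelfAdjoint.star_eq, Matrix.star_apply]
      have h2 : Matrix.single i j (star (X q p)) = star (Matrix.single j i (X q p)) := by
        rw [Matrix.star_eq_conjTranspose, Matrix.conjTranspose_single]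
      simp only [N, Matrix.conjTranspose_apply, Matrix.of_apply, ofMatrixFunctional_apply]
      rw [h1, h2, hstar]
    · obtain ⟨Y, rfl⟩ := hX
      have h := hpos _ (matPos_gram fun r i => ∑ p, ξ (p, i) • Y r p)
      convert h using 1
      have h1 : (Matrix.of fun i j => ∑ r, star (∑ p, ξ (p, i) • Y r p) * ∑ q, ξ (q, j) • Y r q)
          = ∑ p, ∑ i, ∑ q, ∑ j, (star (ξ (p, i)) * ξ (q, j)) •
            Matrix.single i j ((star Y * Y) p q) := by
        ext i j
        simp only [Matrix.of_apply, Matrix.sum_apply, Matrix.smul_apply, Matrix.single_apply,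
          Matrix.mul_apply, Matrix.star_apply, star_sum, Finset.sum_mul_sum, star_smul, ite_and,
          smul_ite, smul_zero, Finset.sum_ite_irrel, Finset.sum_const_zero,
          Finset.sum_ite_eq', Finset.mem_univ, if_true, smul_mul_smul_comm, Finset.smul_sum]
        exact Finset.sum_comm.trans (Finset.sum_congr rfl fun p _ => Finset.sum_comm)
      rw [h1]
      simp only [dotProduct, Matrix.mulVec, Fintype.sum_prod_type, map_sum, map_smul, N,
        Matrix.of_apply, ofMatrixFunctional_apply, Finset.mul_sum, smul_eq_mul, Pi.star_apply]
      refine Finset.sum_congr rfl fun p _ => Finset.sum_congr rfl fun i _ =>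
        Finset.sum_congr rfl fun q _ => Finset.sum_congr rfl fun j _ => by ring
  obtain ⟨R, hR⟩ := hN.exists_eq_conjTranspose_mul_self
  refine ⟨Matrix.of fun p q => Matrix.of fun i j => R (p, i) (q, j), ?_⟩
  ext p q i j
  have := congrFun (congrFun hR (p, i)) (q, j)
  simpa [N, Matrix.mul_apply, Matrix.star_apply, Fintype.sum_prod_type, Matrix.sum_apply]
    using this

/-- Arveson's extension theorem for maps into a matrix algebra: an `n`-positive map into `n × n`
matrices extends to a completely positive map on the whole C*-algebra. -/
theorem exists_isCP_extension {G : Type*} [AddCommGroup G] [Module ℂ G] {n : ℕ}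
    {J : G →ₗ[ℂ] B} (hJ : Function.Injective J) {u : G} (hu : J u = 1)
    (Ψ : G →ₗ[ℂ] Matrix (Fin n) (Fin n) ℂ)
    (hpos : ∀ X : Matrix (Fin n) (Fin n) G, MatPos (X.map J + star (X.map J)) →
      0 ≤ (∑ i, ∑ j, Ψ (X i j) i j).re) :
    ∃ Φ : B →ₗ[ℂ] Matrix (Fin n) (Fin n) ℂ, IsCP Φ ∧ ∀ x, Φ (J x) = Ψ x := by
  let JM : Matrix (Fin n) (Fin n) G →ₗ[ℝ] Matrix (Fin n) (Fin n) B :=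
    (J.mapMatrix (m := Fin n) (n := Fin n)).restrictScalars ℝ
  have hJM (X) : JM X = X.map J := rfl
  have hinj : Function.Injective JM := Matrix.map_injective hJ
  let σ : Matrix (Fin n) (Fin n) G →ₗ[ℝ] ℝ :=
    Complex.reLm ∘ₗ (matrixPairing Ψ).restrictScalars ℝ
  have hσ (X) : σ X = (matrixPairing Ψ X).re := rfl
  let e := LinearEquiv.ofInjective JM hinj
  let f : Matrix (Fin n) (Fin n) B →ₗ.[ℝ] ℝ := ⟨LinearMap.range JM, σ ∘ₗ e.symm.toLinearMap⟩
  have hf (X : Matrix (Fin n) (Fin n) G) : f (e X) = σ X := by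
    change σ (e.symm (e X)) = σ X
    rw [e.symm_apply_apply]
  obtain ⟨g, hgf, hg⟩ := riesz_extension (rePosCone B n) f
    (by
      intro x hx
      obtain ⟨X, rfl⟩ := e.surjective x
      rw [hf, hσ, matrixPairing_apply]
      exact hpos X hx)
    (by
      intro Y
      obtain ⟨c, hc⟩ := exists_matPos_smul_one_add (IsSelfAdjoint.add_star_self Y)
      refine ⟨e (((c / 2 : ℝ) : ℂ) • Matrix.diagonal fun _ => u), ?_⟩
      have h1 : ((e (((c / 2 : ℝ) : ℂ) • Matrix.diagonal fun _ => u) : LinearMap.range JM) :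
          Matrix (Fin n) (Fin n) B) = ((c / 2 : ℝ) : ℂ) • 1 := by
        rw [LinearEquiv.ofInjective_apply, hJM]
        ext i j
        by_cases hij : i = j <;> simp [hij, hu, -Complex.coe_smul, -Complex.ofReal_div]
      rw [mem_rePosCone, h1]
      convert hc using 1
      rw [star_add, star_smul, star_one, RCLike.star_def, Complex.conj_ofReal]
      have h2 : (c : ℂ) • (1 : Matrix (Fin n) (Fin n) B)
          = ((c / 2 : ℝ) : ℂ) • 1 + ((c / 2 : ℝ) : ℂ) • 1 := by
        rw [← add_smul, ← Complex.ofReal_add, add_halves]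
      rw [h2]
      abel)
  have hgJ (X : Matrix (Fin n) (Fin n) G) : g (JM X) = (matrixPairing Ψ X).re := by
    rw [← hσ, ← hf, ← hgf]
    rfl
  refine ⟨ofMatrixFunctional (Module.Dual.extendRCLike (𝕜 := ℂ) g),
    isCP_ofMatrixFunctional (extendRCLike_star hg) fun X => extendRCLike_nonneg hg, fun x => ?_⟩
  refine Matrix.ext fun i j => ?_
  have h1 : Matrix.single i j (J x) = JM (Matrix.single i j x) := by
    rw [hJM, Matrix.map_single]
  have h2 : Complex.I • JM (Matrix.single i j x) = JM (Complex.I • Matrix.single i j x) := by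
    change Complex.I • J.mapMatrix _ = J.mapMatrix (Complex.I • _)
    rw [map_smul]
  have h3 : matrixPairing Ψ (Matrix.single i j x) = Ψ x i j := by
    rw [matrixPairing_apply, Finset.sum_eq_single i, Finset.sum_eq_single j]
    · simp
    · intro b _ hb
      simp [hb.symm]
    · simp
    · intro b _ hb
      simp [hb.symm]
    · simp
  rw [ofMatrixFunctional_apply, Module.Dual.extendRCLike_apply, RCLike.I_to_complex, h1, h2, hgJ, hgJ, map_smul, h3]
  apply Complex.ext <;> simp

end Extension

section OrderUnit

variable {B C : Type*} [CStarAlgebra B] [CStarAlgebra C]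

theorem MatPos.of_map_injective {φ : B →⋆ₐ[ℂ] C} (hφ : Function.Injective φ) {k : ℕ}
    {X : Matrix (Fin k) (Fin k) B} (hX : MatPos (X.map φ)) : MatPos X := by
  have hmap : (X - (matNorm X : ℂ) • 1).map φ = X.map φ - (matNorm X : ℂ) • 1 := by
    change φ.toAlgHom.mapMatrix _ = φ.toAlgHom.mapMatrix X - _
    rw [map_sub, map_smul, map_one]
  have hnorm (Y : Matrix (Fin k) (Fin k) B) : matNorm (Y.map φ) = matNorm Y :=
    matNorm_map_of_injective (φ : B →⋆ₙₐ[ℂ] C) hφ Y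
  have hsaX : IsSelfAdjoint X := by
    refine Matrix.ext fun i j => hφ ?_
    have := congrFun (congrFun hX.isSelfAdjoint.star_eq i) j
    simpa [Matrix.star_apply, map_star] using this
  have hneg := matPos_smul_one_add hX.isSelfAdjoint.neg
    (c := matNorm X) (by
      rw [← hnorm X]
      simp [matNorm])
  have h2 : matNorm (X - (matNorm X : ℂ) • 1) ≤ matNorm X := by
    rw [← hnorm, hmap]
    refine matNorm_le_of_matPos (hX.isSelfAdjoint.sub ?_) (matNorm_nonneg X) ?_ ?_
    · rw [IsSelfAdjoint, star_smul, star_one, RCLike.star_def, Complex.conj_ofReal]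
    · simpa using hX
    · have := hneg.add (MatPos.smul (X := 1) ⟨1, by simp⟩ (matNorm_nonneg X))
      convert this using 1
      abel
  have h3 := matPos_smul_one_add (hsaX.sub ?_) h2
  · simpa using h3
  · rw [IsSelfAdjoint, star_smul, star_one, RCLike.star_def, Complex.conj_ofReal]

/-- Scalar matrices as matrices over a C*-algebra. -/
noncomputable def scalarMat (B : Type*) [CStarAlgebra B] {n : ℕ} :
    Matrix (Fin n) (Fin n) ℂ →⋆ₐ[ℂ] Matrix (Fin n) (Fin n) B where
  toAlgHom := (Algebra.ofId ℂ B).mapMatrix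
  map_star' d := by
    ext i j
    simpa [Matrix.star_apply, Algebra.ofId_apply] using algebraMap_star_comm (A := B) (d j i)

theorem scalarMat_apply {n : ℕ} (d : Matrix (Fin n) (Fin n) ℂ) (i j : Fin n) :
    scalarMat B d i j = d i j • (1 : B) :=
  Algebra.algebraMap_eq_smul_one _

theorem matPos_of_scalarMat [Nontrivial B] {n : ℕ} {d : Matrix (Fin n) (Fin n) ℂ}
    (hd : MatPos (scalarMat B d)) : MatPos d :=
  MatPos.of_map_injective (φ := StarAlgHom.ofId ℂ B) (algebraMap ℂ B).injective hd

open ComplexOrder in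
theorem MatPos.exists_add_eq {n : ℕ} {d : Matrix (Fin n) (Fin n) ℂ} (hd : MatPos d) {t : ℝ}
    (ht : 0 < t) : ∃ K L : Matrix (Fin n) (Fin n) ℂ,
      d + (t : ℂ) • 1 = star K * K ∧ K * L = 1 ∧ L * K = 1 := by
  obtain ⟨Y, rfl⟩ := hd
  have h1 : (star Y * Y + (t : ℂ) • 1 : Matrix (Fin n) (Fin n) ℂ).PosDef :=
    Matrix.PosDef.posSemidef_add (Matrix.posSemidef_conjTranspose_mul_self Y)
      (Matrix.PosDef.one.smul (by exact_mod_cast ht))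
  obtain ⟨K, hK⟩ := h1.posSemidef.exists_eq_conjTranspose_mul_self
  have h2 := h1.isUnit
  rw [hK] at h2
  have h3 : IsUnit K := isUnit_of_mul_isUnit_right h2
  obtain ⟨u, rfl⟩ := h3
  exact ⟨u, ↑u⁻¹, hK, by simp, by simp⟩

/-- Conjugation of a matrix with entries in a vector space by a scalar matrix. -/
def scalarConj {G : Type*} [AddCommGroup G] [Module ℂ G] {n : ℕ} (h : Matrix (Fin n) (Fin n) ℂ)
    (X : Matrix (Fin n) (Fin n) G) : Matrix (Fin n) (Fin n) G :=
  Matrix.of fun i j => ∑ q, ∑ p, (star (h p i) * h q j) • X p q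

theorem map_scalarConj {G : Type*} [AddCommGroup G] [Module ℂ G] {n : ℕ}
    (h : Matrix (Fin n) (Fin n) ℂ) (X : Matrix (Fin n) (Fin n) G) (L : G →ₗ[ℂ] B) :
    (scalarConj h X).map L = star (scalarMat B h) * X.map L * scalarMat B h := by
  ext i j
  simp only [scalarConj, Matrix.map_apply, Matrix.of_apply, map_sum, map_smul, Matrix.mul_apply,
    Matrix.star_apply, scalarMat_apply, star_smul, star_one, smul_mul_assoc, one_mul,
    mul_smul_comm, mul_one, Finset.smul_sum, smul_smul]
  simp only [mul_comm]

theorem matPos_smul_add_of_matNorm_le [Nontrivial B] {G : Type*} [AddCommGroup G] [Module ℂ G]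
    {J : G →ₗ[ℂ] C} {V : G →ₗ[ℂ] B} {n : ℕ} {c : ℝ}
    (hn : ∀ X : Matrix (Fin n) (Fin n) G, matNorm (X.map J) ≤ c * matNorm (X.map V))
    (hc : 0 ≤ c) {f : Matrix (Fin n) (Fin n) G} {d : Matrix (Fin n) (Fin n) ℂ}
    (hf : IsSelfAdjoint (f.map J)) (h1 : MatPos (scalarMat B d + f.map V))
    (h2 : MatPos (scalarMat B d - f.map V)) {t : ℝ} (ht : 0 < t) :
    MatPos ((c : ℂ) • scalarMat C (d + (t : ℂ) • 1) + f.map J) := by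
  have hd : MatPos d := by
    have h3 := (h1.add h2).smul (r := 1 / 2) (by norm_num)
    refine matPos_of_scalarMat (B := B) ?_
    convert h3 using 1
    rw [add_add_sub_cancel, ← two_smul ℂ, smul_smul]
    norm_num
  obtain ⟨K, L, hK, hKL, hLK⟩ := hd.exists_add_eq ht
  have hone : MatPos ((t : ℂ) • (1 : Matrix (Fin n) (Fin n) B)) :=
    MatPos.smul ⟨1, by simp⟩ ht.le
  have hKL' (D : Type _) [CStarAlgebra D] : scalarMat D K * scalarMat D L = 1 := by
    rw [← map_mul, hKL, map_one]
  have hLK' (D : Type _) [CStarAlgebra D] : scalarMat D L * scalarMat D K = 1 := by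
    rw [← map_mul, hLK, map_one]
  have hunit : star (scalarMat B L) * (scalarMat B d + (t : ℂ) • 1) * scalarMat B L = 1 := by
    have : scalarMat B d + (t : ℂ) • 1 = star (scalarMat B K) * scalarMat B K := by
      rw [← map_star, ← map_mul, ← hK, map_add, map_smul, map_one]
    rw [this, mul_assoc, mul_assoc, hKL', mul_one, ← star_mul, hKL', star_one]
  have e1 : MatPos (((1 : ℝ) : ℂ) • 1 + (scalarConj L f).map V) := by
    convert (h1.add hone).conj (scalarMat B L) using 1
    rw [map_scalarConj, add_right_comm, mul_add, add_mul, hunit, Complex.ofReal_one, one_smul]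
  have e2 : MatPos (((1 : ℝ) : ℂ) • 1 - (scalarConj L f).map V) := by
    convert (h2.add hone).conj (scalarMat B L) using 1
    rw [map_scalarConj, sub_add_eq_add_sub, mul_sub, sub_mul, hunit, Complex.ofReal_one, one_smul]
  have hsa : IsSelfAdjoint ((scalarConj L f).map V) := by
    simpa using e1.isSelfAdjoint.sub (IsSelfAdjoint.one (Matrix (Fin n) (Fin n) B))
  have hle : matNorm ((scalarConj L f).map J) ≤ c :=
    (hn _).trans (mul_le_of_le_one_right hc (matNorm_le_of_matPos hsa zero_le_one e1 e2))
  have hsaJ : IsSelfAdjoint ((scalarConj L f).map J) := by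
    rw [map_scalarConj]
    exact hf.conjugate' _
  convert (matPos_smul_one_add hsaJ hle).conj (scalarMat C K) using 1
  rw [map_scalarConj, mul_add, add_mul, mul_smul_comm, smul_mul_assoc, mul_one, ← map_star,
    ← map_mul, ← hK]
  congr 1
  rw [map_star, mul_assoc, mul_assoc (star (scalarMat C L) * _), hLK', mul_one, ← mul_assoc,
    ← star_mul, hLK', star_one, one_mul]

end OrderUnit

section OperatorSystem

open scoped Matrix.Norms.L2Operator

variable {B C : Type*} [CStarAlgebra B] [CStarAlgebra C] {E : Submodule ℂ C}

/-- Twice the real part of a matrix over an operator system. -/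
noncomputable def addStar (hE : ∀ x ∈ E, star x ∈ E) {n : ℕ} (X : Matrix (Fin n) (Fin n) E) :
    Matrix (Fin n) (Fin n) E :=
  Matrix.of fun i j => X i j + ⟨star (X j i : C), hE _ (X j i).2⟩

theorem map_addStar {D : Type*} [CStarAlgebra D] (hE : ∀ x ∈ E, star x ∈ E) {L : E →ₗ[ℂ] D}
    (hL : ∀ x : E, L ⟨star (x : C), hE _ x.2⟩ = star (L x)) {n : ℕ}
    (X : Matrix (Fin n) (Fin n) E) : (addStar hE X).map L = X.map L + star (X.map L) := by
  ext i j
  simp [addStar, hL, Matrix.star_apply]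

theorem map_star_of_matPos {D : Type*} [CStarAlgebra D] (h1 : (1 : C) ∈ E)
    (hE : ∀ x ∈ E, star x ∈ E) {L : E →ₗ[ℂ] D} (hL1 : L ⟨1, h1⟩ = 1)
    (hL : ∀ (k : ℕ) (X : Matrix (Fin k) (Fin k) E), MatPos (X.map E.subtype) → MatPos (X.map L))
    (x : E) : L ⟨star (x : C), hE _ x.2⟩ = star (L x) :=
  (two_positive_bound (J := E.subtype) (u := ⟨1, h1⟩) zero_le_one rfl (by simpa using hL1)
    (hL 2) (x := x) (y := ⟨star (x : C), hE _ x.2⟩) rfl).1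

theorem re_sum_addStar (hE : ∀ x ∈ E, star x ∈ E) {n : ℕ}
    {L : E →ₗ[ℂ] Matrix (Fin n) (Fin n) ℂ}
    (hL : ∀ x : E, L ⟨star (x : C), hE _ x.2⟩ = star (L x)) (X : Matrix (Fin n) (Fin n) E) :
    (∑ i, ∑ j, L (addStar hE X i j) i j).re = 2 * (∑ i, ∑ j, L (X i j) i j).re := by
  have h : ∑ i, ∑ j, L (addStar hE X i j) i j
      = ∑ i, ∑ j, L (X i j) i j + star (∑ i, ∑ j, L (X i j) i j) := by
    simp only [star_sum]
    rw [Finset.sum_comm (f := fun i j => star (L (X i j) i j)), ← Finset.sum_add_distrib]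
    refine Finset.sum_congr rfl fun i _ => ?_
    rw [← Finset.sum_add_distrib]
    refine Finset.sum_congr rfl fun j _ => ?_
    simp [addStar, hL, Matrix.star_apply]
  rw [h, Complex.add_re, RCLike.star_def, Complex.conj_re, two_mul]

/-- Arveson's extension theorem for unital completely positive maps from an operator system into
a matrix algebra. -/
theorem exists_isCP_extension_of_operatorSystem (h1 : (1 : C) ∈ E) (hE : ∀ x ∈ E, star x ∈ E)
    {n : ℕ} {L : E →ₗ[ℂ] Matrix (Fin n) (Fin n) ℂ} (hL1 : L ⟨1, h1⟩ = 1)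
    (hL : ∀ (k : ℕ) (X : Matrix (Fin k) (Fin k) E), MatPos (X.map E.subtype) → MatPos (X.map L)) :
    ∃ Φ : C →ₗ[ℂ] Matrix (Fin n) (Fin n) ℂ, IsCP Φ ∧ ∀ x : E, Φ x = L x := by
  refine exists_isCP_extension (J := E.subtype) E.injective_subtype (u := ⟨1, h1⟩) rfl L
    fun X hX => ?_
  rw [← map_addStar hE (fun _ => rfl)] at hX
  have h := (hL n _ hX).re_sum_nonneg
  simp only [Matrix.map_apply] at h
  rw [re_sum_addStar hE (map_star_of_matPos h1 hE hL1 hL)] at h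
  linarith

theorem exists_isCP_sub_eq [Nontrivial B] (h1 : (1 : C) ∈ E) (hE : ∀ x ∈ E, star x ∈ E)
    {V : E →ₗ[ℂ] B} (hV1 : V ⟨1, h1⟩ = 1)
    (hV : ∀ (k : ℕ) (X : Matrix (Fin k) (Fin k) E), MatPos (X.map E.subtype) → MatPos (X.map V))
    (hVinj : Function.Injective V) {n : ℕ} {δ : ℝ} (hδ : 0 < δ)
    (hn : ∀ X : Matrix (Fin n) (Fin n) E,
      matNorm (X.map E.subtype) ≤ (1 + δ) * matNorm (X.map V))
    {S : E →ₗ[ℂ] Matrix (Fin n) (Fin n) ℂ} (hS1 : S ⟨1, h1⟩ = 1)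
    (hS : ∀ (k : ℕ) (X : Matrix (Fin k) (Fin k) E), MatPos (X.map E.subtype) → MatPos (X.map S)) :
    ∃ P N : B →ₗ[ℂ] Matrix (Fin n) (Fin n) ℂ, IsCP P ∧ IsCP N ∧
      P 1 + N 1 = ((1 + δ : ℝ) : ℂ) • 1 ∧ ∀ x : E, P (V x) - N (V x) = S x := by
  have hVstar := map_star_of_matPos h1 hE hV1 hV
  have hSstar := map_star_of_matPos h1 hE hS1 hS
  let j : ℂ →ₗ[ℂ] B := LinearMap.toSpanSingleton ℂ B 1
  let J : E × ℂ →ₗ[ℂ] B × B := LinearMap.prod (V.coprod j) ((-V).coprod j)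
  let Ψ : E × ℂ →ₗ[ℂ] Matrix (Fin n) (Fin n) ℂ :=
    S.coprod (LinearMap.toSpanSingleton ℂ _ (((1 + δ : ℝ) : ℂ) • 1))
  have hJ (e : E) (z : ℂ) : J (e, z) = (V e + z • 1, -V e + z • 1) := rfl
  have hΨ (e : E) (z : ℂ) : Ψ (e, z) = S e + z • ((1 + δ : ℝ) : ℂ) • 1 := rfl
  have hJinj : Function.Injective J := by
    refine (injective_iff_map_eq_zero J).2 ?_
    rintro ⟨e, z⟩ h
    rw [hJ, Prod.mk_eq_zero] at h
    have h2 : (2 * z) • (1 : B) = 0 := by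
      rw [two_mul, add_smul, ← add_zero (0 : B)]
      nth_rewrite 1 [← h.1]
      rw [← h.2]
      abel
    have hz : z = 0 := by simpa using h2
    subst hz
    have he : V e = 0 := by simpa using h.1
    rw [(map_eq_zero_iff V hVinj).1 he, Prod.mk_zero_zero]
  obtain ⟨Φ, hΦ, hΦJ⟩ := exists_isCP_extension hJinj (u := (0, 1)) (by simp [hJ]) Ψ (by
    intro X hX
    set f := addStar hE (X.map Prod.fst) with hf
    set d : Matrix (Fin n) (Fin n) ℂ := X.map Prod.snd + star (X.map Prod.snd) with hd
    have e1 : MatPos (scalarMat B d + f.map V) := by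
      convert hX.map_starHom (StarAlgHom.fst ℂ B B) using 1
      rw [map_addStar hE hVstar, hd, map_add, map_star]
      ext i j
      simp [Matrix.star_apply, scalarMat_apply, hJ]
      abel
    have e2 : MatPos (scalarMat B d - f.map V) := by
      convert hX.map_starHom (StarAlgHom.snd ℂ B B) using 1
      rw [map_addStar hE hVstar, hd, map_add, map_star]
      ext i j
      simp [Matrix.star_apply, scalarMat_apply, hJ]
      abel
    have hfsa : IsSelfAdjoint (f.map E.subtype) := by
      rw [map_addStar hE fun _ => rfl]
      exact IsSelfAdjoint.add_star_self _
    have key (t : ℝ) (ht : 0 < t) :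
        0 ≤ 2 * (∑ i, ∑ j, Ψ (X i j) i j).re + (1 + δ) * t * n := by
      have h2 := matPos_smul_add_of_matNorm_le hn (by linarith) hfsa e1 e2 ht
      let Y : Matrix (Fin n) (Fin n) E :=
        f + Matrix.of fun i j => (((1 + δ : ℝ) : ℂ) * (d + (t : ℂ) • 1) i j) • ⟨1, h1⟩
      have h3 : Y.map E.subtype
          = ((1 + δ : ℝ) : ℂ) • scalarMat C (d + (t : ℂ) • 1) + f.map E.subtype := by
        ext i j
        by_cases hij : i = j <;>
          simp [Y, scalarMat_apply, smul_smul, add_comm, hij, -map_add, -map_smul,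
            -Complex.coe_smul]
      have h4 := (hS n Y (h3 ▸ h2)).re_sum_nonneg
      have h5 := re_sum_addStar hE hSstar (X.map Prod.fst)
      rw [← hf] at h5
      have h6 : ∑ i, ∑ j, (Y.map S) i j i j
          = ∑ i, ∑ j, S (f i j) i j + ∑ i, ((1 + δ : ℝ) : ℂ) * (d i i + t) := by
        have (i j : Fin n) : (Y.map S) i j i j = S (f i j) i j
            + if i = j then ((1 + δ : ℝ) : ℂ) * (d i j + t) else 0 := by
          change S (f i j + (((1 + δ : ℝ) : ℂ) * (d + (t : ℂ) • 1) i j) • ⟨1, h1⟩) i j = _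
          rw [map_add, map_smul, hS1]
          by_cases hij : i = j <;> simp [hij]
        simp [this, Finset.sum_add_distrib]
      have h7 : ∑ i, ∑ j, Ψ (X i j) i j = ∑ i, ∑ j, S ((X.map Prod.fst) i j) i j
          + ∑ i, ((1 + δ : ℝ) : ℂ) * (X i i).2 := by
        have (i j : Fin n) : Ψ (X i j) i j
            = S (X i j).1 i j + if i = j then ((1 + δ : ℝ) : ℂ) * (X i j).2 else 0 := by
          rw [← Prod.mk.eta (p := X i j), hΨ]
          by_cases hij : i = j <;> simp [hij, mul_comm]
        simp [this, Finset.sum_add_distrib]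
      have h8 : (∑ i, ((1 + δ : ℝ) : ℂ) * (d i i + t)).re
          = 2 * (∑ i, ((1 + δ : ℝ) : ℂ) * (X i i).2).re + (1 + δ) * t * n := by
        simp only [Complex.re_sum, Complex.re_ofReal_mul, ← Finset.mul_sum, Complex.add_re, hd,
          Matrix.add_apply, Matrix.star_apply, Matrix.map_apply, RCLike.star_def, Complex.conj_re,
          Finset.sum_add_distrib, Finset.sum_const, Finset.card_univ,
          Fintype.card_fin, nsmul_eq_mul, ← Complex.ofReal_natCast, ← Complex.ofReal_mul,
          Complex.ofReal_re]
        ring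
      rw [h6, Complex.add_re, h5, h8] at h4
      rw [h7, Complex.add_re]
      linarith
    refine nonneg_of_mul_nonneg_right (le_of_forall_pos_le_add fun r hr => ?_) (zero_lt_two' ℝ)
    have hden : 0 < (1 + δ) * (n + 1) := by positivity
    refine (key (r / ((1 + δ) * (n + 1))) (div_pos hr hden)).trans
      (add_le_add_right ?_ _)
    rw [mul_div_assoc', div_mul_eq_mul_div, div_le_iff₀ hden]
    nlinarith [mul_pos hr (by linarith : 0 < 1 + δ)])
  refine ⟨Φ ∘ₗ LinearMap.inl ℂ B B, Φ ∘ₗ LinearMap.inr ℂ B B,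
    hΦ.comp fun k X hX => hX.map_starHom (NonUnitalStarAlgHom.inl ℂ B B),
    hΦ.comp fun k X hX => hX.map_starHom (NonUnitalStarAlgHom.inr ℂ B B), ?_, fun x => ?_⟩
  · have h := hΦJ (0, 1)
    rw [hJ, hΨ, map_zero, map_zero, neg_zero, zero_add, zero_add, one_smul, one_smul] at h
    rw [← h]
    simp [← map_add]
  · have h := hΦJ (x, 0)
    rw [hJ, hΨ, zero_smul, add_zero, zero_smul, add_zero, add_zero] at h
    rw [← h]
    simp [← map_sub]

/-- If an injective unital completely positive map on an operator system has an inverse whose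
`n`-th amplification is almost contractive, then every unital completely positive map into
`n × n` matrices factors approximately through it. -/
theorem exists_isCP_approx_factor [Nontrivial B] (h1 : (1 : C) ∈ E) (hE : ∀ x ∈ E, star x ∈ E)
    {V : E →ₗ[ℂ] B} (hV1 : V ⟨1, h1⟩ = 1)
    (hV : ∀ (k : ℕ) (X : Matrix (Fin k) (Fin k) E), MatPos (X.map E.subtype) → MatPos (X.map V))
    (hVinj : Function.Injective V) {n : ℕ} {δ : ℝ} (hδ : 0 < δ)
    (hn : ∀ X : Matrix (Fin n) (Fin n) E,
      matNorm (X.map E.subtype) ≤ (1 + δ) * matNorm (X.map V))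
    {S : E →ₗ[ℂ] Matrix (Fin n) (Fin n) ℂ} (hS1 : S ⟨1, h1⟩ = 1)
    (hS : ∀ (k : ℕ) (X : Matrix (Fin k) (Fin k) E), MatPos (X.map E.subtype) → MatPos (X.map S)) :
    ∃ Φ : B →ₗ[ℂ] Matrix (Fin n) (Fin n) ℂ, Φ 1 = 1 ∧ IsCP Φ ∧
      ∀ x : E, ‖Φ (V x) - S x‖ ≤ δ * ‖(x : C)‖ := by
  obtain ⟨P, N, hP, hN, hadd, hPN⟩ := exists_isCP_sub_eq h1 hE hV1 hV hVinj hδ hn hS1 hS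
  have hsub : P 1 - N 1 = 1 := by rw [← hV1, hPN, hS1]
  have hP1 : P 1 = ((1 + δ / 2 : ℝ) : ℂ) • 1 := by
    have : P 1 = (1 / 2 : ℂ) • ((P 1 + N 1) + (P 1 - N 1)) := by module
    rw [this, hadd, hsub]
    push_cast
    module
  have hN1 : N 1 = ((δ / 2 : ℝ) : ℂ) • 1 := by
    have : N 1 = (1 / 2 : ℂ) • ((P 1 + N 1) - (P 1 - N 1)) := by module
    rw [this, hadd, hsub]
    push_cast
    module
  have hr : 0 < 1 + δ / 2 := by positivity
  have hr' : ((1 + δ / 2 : ℝ) : ℂ) ≠ 0 := by exact_mod_cast hr.ne'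
  let Q : B →ₗ[ℂ] Matrix (Fin n) (Fin n) ℂ := (((1 + δ / 2)⁻¹ : ℝ) : ℂ) • P
  have hQP (b : B) : P b = ((1 + δ / 2 : ℝ) : ℂ) • Q b := by
    rw [LinearMap.smul_apply, smul_smul, ← Complex.ofReal_mul, mul_inv_cancel₀ hr.ne',
      Complex.ofReal_one, one_smul]
  have hQ1 : Q 1 = 1 := by
    refine smul_right_injective _ hr' ?_
    change _ • _ = _ • _
    rw [← hQP, hP1]
  have hQ : IsCP Q := fun k X hX => (hP k X hX).smul (inv_nonneg.2 hr.le)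
  refine ⟨Q, hQ1, hQ, fun x => ?_⟩
  have hVx : ‖V x‖ ≤ ‖(x : C)‖ := by
    simpa using (two_positive_bound (J := E.subtype) (u := ⟨1, h1⟩) zero_le_one rfl
      (by simpa using hV1) (hV 2) (x := x) (y := ⟨star (x : C), hE _ x.2⟩) rfl).2
  have h5 : Q (V x) - S x = N (V x) - ((δ / 2 : ℝ) : ℂ) • Q (V x) := by
    rw [← hPN, hQP]
    push_cast
    module
  have h6 := hN.norm_le (by positivity) hN1 (V x)
  have h7 := hQ.norm_le zero_le_one (by simpa using hQ1) (V x)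
  rw [h5]
  refine (norm_sub_le _ _).trans ?_
  rw [norm_smul, Complex.norm_real, Real.norm_of_nonneg (by positivity)]
  nlinarith

end OperatorSystem

section NuclearEmbedding

theorem subsingleton_of_isEmpty_matrix {R : Type*} [Ring R] [Module ℂ R]
    {T : Matrix (Fin 0) (Fin 0) ℂ →ₗ[ℂ] R} (hT : T 1 = 1) : Subsingleton R := by
  refine subsingleton_of_zero_eq_one ?_
  rw [← hT, Subsingleton.elim (1 : Matrix (Fin 0) (Fin 0) ℂ) 0, map_zero]

theorem matPos_of_map_coe {C : Type*} [CStarAlgebra C] {A : StarSubalgebra ℂ C}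
    (hA : IsClosed (A : Set C)) {k : ℕ} {X : Matrix (Fin k) (Fin k) A}
    (hX : MatPos (X.map A.subtype)) : MatPos X := by
  let _ : CStarAlgebra A := StarSubalgebra.cstarAlgebra A (h_closed := hA)
  exact MatPos.of_map_injective (φ := A.subtype) Subtype.val_injective hX

open scoped Matrix.Norms.L2Operator in
theorem exists_isCP_approx_of_nuclear {B₁ B₂ C : Type*} [CStarAlgebra B₁] [CStarAlgebra B₂]
    [CStarAlgebra C] [Nontrivial B₁] {E : Submodule ℂ C} [FiniteDimensional ℂ E] (h1 : (1 : C) ∈ E)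
    (hE : ∀ x ∈ E, star x ∈ E) {n : ℕ} {S : E →ₗ[ℂ] Matrix (Fin n) (Fin n) ℂ}
    (hS1 : S ⟨1, h1⟩ = 1)
    (hS : ∀ (k : ℕ) (X : Matrix (Fin k) (Fin k) E), MatPos (X.map E.subtype) → MatPos (X.map S))
    {T : Matrix (Fin n) (Fin n) ℂ →ₗ[ℂ] C} (hT1 : T 1 = 1) (hT : IsCP T) {η : ℝ}
    (hST : ∀ x : E, ‖T (S x) - x‖ ≤ η * ‖(x : C)‖)
    (hB₂ : ∃ (d : ℕ → ℕ) (S : ∀ j : ℕ, B₂ →ₗ[ℂ] Matrix (Fin (d j)) (Fin (d j)) ℂ)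
      (T : ∀ j : ℕ, Matrix (Fin (d j)) (Fin (d j)) ℂ →ₗ[ℂ] B₂),
      (∀ j, S j 1 = 1 ∧ IsCP (S j) ∧ T j 1 = 1 ∧ IsCP (T j)) ∧
      ∀ b : B₂, Filter.Tendsto (fun j => ‖T j (S j b) - b‖) Filter.atTop (nhds 0))
    {V : E →ₗ[ℂ] B₁} (hV1 : V ⟨1, h1⟩ = 1)
    (hV : ∀ (k : ℕ) (X : Matrix (Fin k) (Fin k) E), MatPos (X.map E.subtype) → MatPos (X.map V))
    {W : E →ₗ[ℂ] B₂} (hW1 : W ⟨1, h1⟩ = 1)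
    (hW : ∀ (k : ℕ) (X : Matrix (Fin k) (Fin k) E), MatPos (X.map E.subtype) → MatPos (X.map W))
    (hVinj : Function.Injective V) {δ : ℝ} (hδ : 0 < δ)
    (hn : ∀ X : Matrix (Fin n) (Fin n) E,
      matNorm (X.map E.subtype) ≤ (1 + δ) * matNorm (X.map V)) {r : ℝ} (hr : 0 < r) :
    ∃ Q : B₁ →ₗ[ℂ] B₂, Q 1 = 1 ∧ IsCP Q ∧
      ∀ x : E, ‖Q (V x) - W x‖ ≤ (δ + η + r) * ‖(x : C)‖ := by
  obtain ⟨Φ, hΦ1, hΦ, hΦV⟩ := exists_isCP_approx_factor h1 hE hV1 hV hVinj hδ hn hS1 hS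
  obtain ⟨d, S', T', hST', hlim⟩ := hB₂
  let v := Module.finBasis ℂ E
  obtain ⟨K, hK, hKv⟩ := v.exists_opNorm_le (F := B₂)
  have hev : ∀ᶠ j in Filter.atTop, ∀ i, ‖T' j (S' j (W (v i))) - W (v i)‖ < r / K :=
    Filter.eventually_all.2 fun i => (hlim _).eventually_lt_const (div_pos hr hK)
  obtain ⟨j, hj⟩ := hev.exists
  obtain ⟨hS'1, hS', hT'1, hT'⟩ := hST' j
  have hj' (x : E) : ‖T' j (S' j (W x)) - W x‖ ≤ r * ‖(x : C)‖ := by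
    let D : E →L[ℂ] B₂ := LinearMap.toContinuousLinearMap (T' j ∘ₗ S' j ∘ₗ W - W)
    have h : ‖D‖ ≤ K * (r / K) := hKv (u := D) (div_pos hr hK).le fun i => (hj i).le
    rw [mul_div_cancel₀ _ hK.ne'] at h
    exact D.le_of_opNorm_le h x
  obtain ⟨R, hR, hRW⟩ := exists_isCP_extension_of_operatorSystem h1 hE (L := S' j ∘ₗ W)
    (by simp [hW1, hS'1]) fun k X hX => by simpa [Matrix.map_map] using! hS' k _ (hW k X hX)
  have hR1 : R 1 = 1 := by simpa [hW1, hS'1] using hRW ⟨1, h1⟩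
  let P : C →ₗ[ℂ] B₂ := T' j ∘ₗ R
  have hP : IsCP P := hT'.comp hR
  have hP1 : P 1 = 1 := by simp [P, hR1, hT'1]
  have hPT : IsCP (P ∘ₗ T) := hP.comp hT
  have hPT1 : (P ∘ₗ T) 1 = 1 := by simp [hT1, hP1]
  refine ⟨(P ∘ₗ T) ∘ₗ Φ, by rw [LinearMap.comp_apply, hΦ1, hPT1], hPT.comp hΦ, fun x => ?_⟩
  have e : ((P ∘ₗ T) ∘ₗ Φ) (V x) - W x = (P ∘ₗ T) (Φ (V x) - S x) + P (T (S x) - x)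
      + (T' j (S' j (W x)) - W x) := by
    have hPx : P x = T' j (S' j (W x)) := congrArg (T' j) (hRW x)
    rw [map_sub, map_sub, hPx]
    simp
  have b1 := hPT.norm_le zero_le_one (by simpa using hPT1) (Φ (V x) - S x)
  have b2 := hP.norm_le zero_le_one (by simpa using hP1) (T (S x) - x)
  rw [e]
  refine (norm_add₃_le).trans ?_
  linarith [hΦV x, hST x, hj' x]

end NuclearEmbedding

/-- (Lemma 1.10 of the paper.)  Let `A ⊆ B(H)` be a separable unital
C*-subalgebra whose inclusion is nuclear, `E ⊆ A` a finite-dimensional operator system,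
and `ε > 0`.  For every `0 ≤ δ < ε` there is `n ≥ 1` such that: whenever `B₁, B₂` are
separable unital C*-algebras with `B₂` nuclear, and `V : E → B₁`, `W : E → B₂` are unital
completely positive maps with `V` injective and `‖X‖ ≤ (1+δ)·‖X_V‖` for all `n×n` matrices
`X` over `E`, there is a unital completely positive `T : B₁ → B₂` with
`sup{‖T(V x) − W x‖ : x ∈ E, ‖x‖ ≤ 1} < ε`. -/
theorem stmt_12 {H : Type*} [NormedAddCommGroup H] [InnerProductSpace ℂ H] [CompleteSpace H]
    (A : StarSubalgebra ℂ (H →L[ℂ] H)) (hAclosed : IsClosed (A : Set (H →L[ℂ] H)))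
    [TopologicalSpace.SeparableSpace A]
    (hAnucl : ∀ (F : Finset ↥A) (η : ℝ), 0 < η →
      ∃ (k : ℕ) (S : ↥A →ₗ[ℂ] Matrix (Fin k) (Fin k) ℂ)
        (T : Matrix (Fin k) (Fin k) ℂ →ₗ[ℂ] (H →L[ℂ] H)),
        S 1 = 1 ∧ IsCP S ∧ T 1 = 1 ∧ IsCP T ∧
        ∀ a ∈ F, ‖T (S a) - (a : H →L[ℂ] H)‖ < η)
    (E : Submodule ℂ (H →L[ℂ] H)) (hEA : (E : Set (H →L[ℂ] H)) ⊆ (A : Set (H →L[ℂ] H)))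
    (h1E : (1 : H →L[ℂ] H) ∈ E) (hEstar : ∀ x ∈ E, star x ∈ E)
    [FiniteDimensional ℂ ↥E]
    (ε : ℝ) (hε : 0 < ε) :
    ∀ δ : ℝ, 0 ≤ δ → δ < ε →
      ∃ n : ℕ, 1 ≤ n ∧
        ∀ (B₁ : Type*) (B₂ : Type*)
          [NormedRing B₁] [StarRing B₁] [CStarRing B₁] [CompleteSpace B₁]
          [NormedAlgebra ℂ B₁] [StarModule ℂ B₁] [TopologicalSpace.SeparableSpace B₁]
          [NormedRing B₂] [StarRing B₂] [CStarRing B₂] [CompleteSpace B₂]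
          [NormedAlgebra ℂ B₂] [StarModule ℂ B₂] [TopologicalSpace.SeparableSpace B₂],
          (∃ (d : ℕ → ℕ) (S : ∀ j : ℕ, B₂ →ₗ[ℂ] Matrix (Fin (d j)) (Fin (d j)) ℂ)
             (T : ∀ j : ℕ, Matrix (Fin (d j)) (Fin (d j)) ℂ →ₗ[ℂ] B₂),
             (∀ j, S j 1 = 1 ∧ IsCP (S j) ∧ T j 1 = 1 ∧ IsCP (T j)) ∧
             ∀ b : B₂, Filter.Tendsto (fun j => ‖T j (S j b) - b‖) Filter.atTop (nhds 0)) →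
          ∀ (V : ↥E →ₗ[ℂ] B₁) (W : ↥E →ₗ[ℂ] B₂),
            V ⟨1, h1E⟩ = 1 →
            (∀ (k : ℕ) (X : Matrix (Fin k) (Fin k) ↥E),
              MatPos (X.map fun e => (e : H →L[ℂ] H)) → MatPos (X.map fun e => V e)) →
            W ⟨1, h1E⟩ = 1 →
            (∀ (k : ℕ) (X : Matrix (Fin k) (Fin k) ↥E),
              MatPos (X.map fun e => (e : H →L[ℂ] H)) → MatPos (X.map fun e => W e)) →
            Function.Injective V →
            (∀ X : Matrix (Fin n) (Fin n) ↥E,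
              matNorm (X.map fun e => (e : H →L[ℂ] H))
                ≤ (1 + δ) * matNorm (X.map fun e => V e)) →
            ∃ T : B₁ →ₗ[ℂ] B₂, T 1 = 1 ∧ IsCP T ∧
              ∃ C : ℝ, C < ε ∧
                ∀ x : ↥E, ‖(x : H →L[ℂ] H)‖ ≤ 1 → ‖T (V x) - W x‖ ≤ C := by
  classical
  intro δ hδ hδε
  have hγ : 0 < (ε - δ) / 4 := by linarith
  let v := Module.finBasis ℂ E
  obtain ⟨K, hK, hKv⟩ := v.exists_opNorm_le (F := H →L[ℂ] H)
  let ι : E →ₗ[ℂ] A := LinearMap.codRestrict A.toSubmodule E.subtype fun x => hEA x.2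
  obtain ⟨k, S, T, hS1, hS, hT1, hT, hST⟩ :=
    hAnucl (Finset.univ.image fun i => ι (v i)) ((ε - δ) / 4 / K) (div_pos hγ hK)
  obtain rfl | hk := Nat.eq_zero_or_pos k
  · refine ⟨1, le_rfl, ?_⟩
    intro B₁ B₂ _ _ _ _ _ _ _ _ _ _ _ _ _ _ _ V W hV1 hV hW1 hW hVinj hVn
    have := subsingleton_of_isEmpty_matrix hT1
    have h0 : (⟨1, h1E⟩ : E) = 0 := Subtype.ext (Subsingleton.elim _ _)
    have : Subsingleton B₂ := subsingleton_of_zero_eq_one (by rw [← hW1, h0, map_zero])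
    exact ⟨0, Subsingleton.elim _ _, fun k X _ => ⟨0, Subsingleton.elim _ _⟩, 0, hε, fun x _ => by
      rw [Subsingleton.elim (_ - _) (0 : B₂), norm_zero]⟩
  refine ⟨k, hk, ?_⟩
  intro B₁ B₂ _ _ _ _ _ _ _ _ _ _ _ _ _ _ hB₂ V W hV1 hV hW1 hW hVinj hVn
  obtain hB₁ | hB₁ := subsingleton_or_nontrivial B₁
  · have h0 : (⟨1, h1E⟩ : E) = 0 := hVinj (Subsingleton.elim _ _)
    have : Subsingleton B₂ := subsingleton_of_zero_eq_one (by rw [← hW1, h0, map_zero])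
    exact ⟨0, Subsingleton.elim _ _, fun k X _ => ⟨0, Subsingleton.elim _ _⟩, 0, hε, fun x _ => by
      rw [Subsingleton.elim (_ - _) (0 : B₂), norm_zero]⟩
  let _ : CStarAlgebra B₁ := {}
  let _ : CStarAlgebra B₂ := {}
  have hSι (m : ℕ) (X : Matrix (Fin m) (Fin m) E) (hX : MatPos (X.map E.subtype)) :
      MatPos (X.map (S ∘ₗ ι)) := by
    have h1 : MatPos (X.map ι) := matPos_of_map_coe hAclosed hX
    simpa [Matrix.map_map] using! hS m _ h1
  have hSTx (x : E) : ‖T ((S ∘ₗ ι) x) - x‖ ≤ (ε - δ) / 4 * ‖(x : H →L[ℂ] H)‖ := by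
    let D : E →L[ℂ] (H →L[ℂ] H) := LinearMap.toContinuousLinearMap (T ∘ₗ S ∘ₗ ι - E.subtype)
    have h : ‖D‖ ≤ K * ((ε - δ) / 4 / K) := hKv (u := D) (div_pos hγ hK).le fun i =>
      (hST _ (Finset.mem_image_of_mem _ (Finset.mem_univ i))).le
    rw [mul_div_cancel₀ _ hK.ne'] at h
    exact D.le_of_opNorm_le h x
  obtain ⟨Q, hQ1, hQ, hQV⟩ := exists_isCP_approx_of_nuclear h1E hEstar (S := S ∘ₗ ι) hS1 hSι
    hT1 hT hSTx hB₂ hV1 hV hW1 hW hVinj (δ := δ + (ε - δ) / 4) (by linarith)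
    (fun X => (hVn X).trans (mul_le_mul_of_nonneg_right (by linarith) (matNorm_nonneg _))) hγ
  refine ⟨Q, hQ1, hQ, δ + (ε - δ) / 4 + (ε - δ) / 4 + (ε - δ) / 4, by linarith, fun x hx =>
    (hQV x).trans (mul_le_of_le_one_right (by linarith) hx)⟩
end

section
/- With the notation of the setup (integers n ≥ 1, m ≥ 1, q = (2n+1)², ζ = exp(2πi/q), the vector ξ = ξ₀/‖ξ₀‖ in ℂ^q, and the diagonal unitary matrix y with entries ζ^{k·m}), one has ‖ξ − y·ξ‖ ≤ (π·√3/4)·(m/(2n+1)). -/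
theorem norm_one_sub_exp_pow_le (q j : ℕ) :
    ‖1 - Complex.exp (2 * Real.pi * Complex.I / (q : ℂ)) ^ j‖ ≤ 2 * Real.pi * j / q := by
  have h : Complex.exp (2 * Real.pi * Complex.I / (q : ℂ)) ^ j
      = Complex.exp (Complex.I * ((2 * Real.pi * j / q : ℝ) : ℂ)) := by
    rw [← Complex.exp_nat_mul]
    congr 1
    push_cast
    ring
  rw [h, norm_sub_rev]
  refine Real.norm_exp_I_mul_ofReal_sub_one_le.trans_eq ?_
  rw [Real.norm_eq_abs, abs_of_nonneg (by positivity)]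

theorem norm_one_sub_pow_eq_of_add_eq {q : ℕ} {z : ℂ} (hz : z ^ q = 1) (hz' : ‖z‖ = 1)
    {k j : ℕ} (hkj : k + j = q) (m : ℕ) : ‖1 - z ^ (k * m)‖ = ‖1 - z ^ (j * m)‖ := by
  have h : z ^ (k * m) * z ^ (j * m) = 1 := by
    rw [← pow_add, ← add_mul, hkj, pow_mul, hz, one_pow]
  calc ‖1 - z ^ (k * m)‖ = ‖(1 - z ^ (k * m)) * z ^ (j * m)‖ := by simp [hz']
    _ = ‖z ^ (j * m) - 1‖ := by rw [sub_mul, h, one_mul]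
    _ = _ := norm_sub_rev _ _

theorem sum_range_sq_mul_sub_sq (x : ℝ) (N : ℕ) :
    ∑ i ∈ Finset.range N, ((i : ℝ) ^ 2 * (x - i) ^ 2)
      = x ^ 2 * ((N - 1) * N * (2 * N - 1) / 6) - 2 * x * ((N - 1) ^ 2 * N ^ 2 / 4)
        + N * (N - 1) * (2 * N - 1) * (3 * N ^ 2 - 3 * N - 1) / 30 := by
  induction N with
  | zero => simp
  | succ k ih => rw [Finset.sum_range_succ, ih]; push_cast; ring

theorem sum_range_sub_sq_add_sq (x : ℝ) (N : ℕ) :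
    ∑ i ∈ Finset.range N, ((x - i) ^ 2 + (i : ℝ) ^ 2)
      = x ^ 2 * N - x * ((N - 1) * N) + (N - 1) * N * (2 * N - 1) / 3 := by
  induction N with
  | zero => simp
  | succ k ih => rw [Finset.sum_range_succ, ih]; push_cast; ring

theorem mul_sum_sq_mul_sub_sq_le (n : ℕ) :
    32 * (2 * ∑ i ∈ Finset.range n, ((i : ℝ) ^ 2 * (n - i) ^ 2))
      ≤ 6 * (n + 1 / 2) ^ 2 * ∑ i ∈ Finset.range n, (((n : ℝ) - i) ^ 2 + (i : ℝ) ^ 2) := by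
  rw [sum_range_sq_mul_sub_sq, sum_range_sub_sq_add_sq]
  have hn : (0 : ℝ) ≤ n := n.cast_nonneg
  rw [← sub_nonneg]
  ring_nf
  positivity

/-- The tent function centred at `0` on `{0, …, q - 1}`, viewed cyclically. -/
noncomputable def cyclicTent (n q k : ℕ) : ℂ :=
  if k < n then (((n - k : ℕ) : ℂ) / (n : ℂ))
  else if k ≤ q - n then 0
  else (((k - (q - n) : ℕ) : ℂ) / (n : ℂ))

theorem sum_cyclicTent_mul {n q : ℕ} (hq : 2 * n ≤ q) (f : ℕ → ℝ) :
    ∑ k ∈ Finset.range q, ‖cyclicTent n q k‖ ^ 2 * f k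
      = (∑ i ∈ Finset.range n, (((n : ℝ) - i) ^ 2 * f i + (i : ℝ) ^ 2 * f (q - n + i)))
        / (n : ℝ) ^ 2 := by
  obtain ⟨r, rfl⟩ := Nat.exists_eq_add_of_le hq
  have hsub : 2 * n + r - n = n + r := by omega
  have hsplit : 2 * n + r = n + r + n := by omega
  rw [hsub]
  conv_lhs => rw [show Finset.range (2 * n + r) = Finset.range (n + r + n) by rw [hsplit]]
  rw [Finset.sum_range_add, Finset.sum_range_add]
  have h₁ : ∑ i ∈ Finset.range n, ‖cyclicTent n (2 * n + r) i‖ ^ 2 * f i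
      = ∑ i ∈ Finset.range n, ((n : ℝ) - i) ^ 2 * f i / (n : ℝ) ^ 2 := by
    refine Finset.sum_congr rfl fun i hi => ?_
    have hi := Finset.mem_range.mp hi
    rw [cyclicTent, if_pos hi, norm_div, Complex.norm_natCast, Complex.norm_natCast,
      Nat.cast_sub hi.le]
    ring
  have h₂ : ∑ i ∈ Finset.range r, ‖cyclicTent n (2 * n + r) (n + i)‖ ^ 2 * f (n + i) = 0 := by
    refine Finset.sum_eq_zero fun i hi => ?_
    have hi := Finset.mem_range.mp hi
    rw [cyclicTent, if_neg (by omega), if_pos (by omega)]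
    simp
  have h₃ : ∑ i ∈ Finset.range n,
      ‖cyclicTent n (2 * n + r) (n + r + i)‖ ^ 2 * f (n + r + i)
      = ∑ i ∈ Finset.range n, (i : ℝ) ^ 2 * f (n + r + i) / (n : ℝ) ^ 2 := by
    refine Finset.sum_congr rfl fun i hi => ?_
    rw [cyclicTent, if_neg (by omega), hsub]
    split_ifs with h
    · obtain rfl : i = 0 := by omega
      simp
    · rw [norm_div, Complex.norm_natCast, Complex.norm_natCast, Nat.add_sub_cancel_left]
      ring
  rw [h₁, h₂, h₃, add_zero, ← Finset.sum_add_distrib, Finset.sum_div]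
  exact Finset.sum_congr rfl fun i _ => (add_div _ _ _).symm

theorem sum_cyclicTent_mul_norm_one_sub_pow_le (n m q : ℕ) (hq : q = (2 * n + 1) ^ 2) :
    ∑ k ∈ Finset.range q, ‖cyclicTent n q k‖ ^ 2
        * ‖1 - Complex.exp (2 * Real.pi * Complex.I / (q : ℂ)) ^ (k * m)‖ ^ 2
      ≤ ((Real.pi * Real.sqrt 3 / 4) * ((m : ℝ) / (2 * (n : ℝ) + 1))) ^ 2
        * ∑ k ∈ Finset.range q, ‖cyclicTent n q k‖ ^ 2 := by
  have hnq : 2 * n ≤ q := by rw [hq]; nlinarith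
  have hq0 : q ≠ 0 := by rw [hq]; positivity
  set z := Complex.exp (2 * Real.pi * Complex.I / (q : ℂ)) with hz
  have hprim : IsPrimitiveRoot z q := Complex.isPrimitiveRoot_exp q hq0
  have hnorm : ‖z‖ = 1 := hprim.norm'_eq_one hq0
  set A : ℝ := 2 * Real.pi * m / q with hA
  have hbound (j : ℕ) : ‖1 - z ^ (j * m)‖ ^ 2 ≤ A ^ 2 * (j : ℝ) ^ 2 := by
    rw [← mul_pow]
    refine pow_le_pow_left₀ (norm_nonneg _) ((norm_one_sub_exp_pow_le q (j * m)).trans_eq ?_) 2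
    push_cast
    ring
  have hone : ∑ k ∈ Finset.range q, ‖cyclicTent n q k‖ ^ 2
      = (∑ i ∈ Finset.range n, (((n : ℝ) - i) ^ 2 + (i : ℝ) ^ 2)) / (n : ℝ) ^ 2 := by
    simpa using sum_cyclicTent_mul hnq fun _ => 1
  rw [sum_cyclicTent_mul hnq fun k => ‖1 - z ^ (k * m)‖ ^ 2, hone, ← mul_div_assoc]
  refine div_le_div_of_nonneg_right ?_ (by positivity)
  have hA' : A ^ 2 * (n + 1 / 2) ^ 2 * 6 = 32 *
      ((Real.pi * Real.sqrt 3 / 4) * ((m : ℝ) / (2 * (n : ℝ) + 1))) ^ 2 := by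
    have h3 : Real.sqrt 3 ^ 2 = 3 := Real.sq_sqrt (by norm_num)
    rw [hA, hq]
    push_cast
    field_simp
    rw [h3]
    ring
  calc _ ≤ ∑ i ∈ Finset.range n, A ^ 2 * (2 * ((i : ℝ) ^ 2 * (n - i) ^ 2)) := by
        refine Finset.sum_le_sum fun i hi => ?_
        have hi := Finset.mem_range.mp hi
        have h₁ := hbound i
        have h₂ := hbound (n - i)
        rw [← norm_one_sub_pow_eq_of_add_eq hprim.pow_eq_one hnorm
          (show q - n + i + (n - i) = q by omega), Nat.cast_sub hi.le] at h₂
        have h₃ := mul_le_mul_of_nonneg_left h₁ (sq_nonneg ((n : ℝ) - i))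
        have h₄ := mul_le_mul_of_nonneg_left h₂ (sq_nonneg (i : ℝ))
        linarith
    _ ≤ _ := by
        rw [← Finset.mul_sum, ← Finset.mul_sum]
        have h := mul_le_mul_of_nonneg_left (mul_sum_sq_mul_sub_sq_le n) (sq_nonneg A)
        rw [← mul_assoc (A ^ 2) (6 * _),
          show A ^ 2 * (6 * ((n : ℝ) + 1 / 2) ^ 2) = A ^ 2 * (n + 1 / 2) ^ 2 * 6 by ring, hA'] at h
        linarith

/-- With `q = (2n+1)²`, `ζ = exp(2πi/q)`, the unit vector
`ξ = ξ₀/‖ξ₀‖ ∈ ℂ^q` and `y` the diagonal unitary with entries `ζ^{k·m}`, one has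
`‖ξ − y·ξ‖ ≤ (π·√3/4)·(m/(2n+1))`. -/
theorem stmt_16 (n m : ℕ) (hn : 1 ≤ n) (hm : 1 ≤ m)
    (q : ℕ) (hq : q = (2 * n + 1) ^ 2)
    (ζ : ℂ) (hζ : ζ = Complex.exp (2 * Real.pi * Complex.I / (q : ℂ)))
    (ξ₀ : EuclideanSpace ℂ (Fin q))
    (hξ₀ : ∀ k : Fin q, ξ₀ k =
      if (k : ℕ) < n then (((n - (k : ℕ) : ℕ) : ℂ) / (n : ℂ))
      else if (k : ℕ) ≤ q - n then 0
      else ((((k : ℕ) - (q - n) : ℕ) : ℂ) / (n : ℂ)))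
    (ξ : EuclideanSpace ℂ (Fin q)) (hξ : ξ = ((‖ξ₀‖ : ℂ))⁻¹ • ξ₀)
    (y : Matrix (Fin q) (Fin q) ℂ)
    (hy : y = Matrix.diagonal fun k : Fin q => ζ ^ ((k : ℕ) * m)) :
    ‖ξ - Matrix.toEuclideanLin y ξ‖
      ≤ (Real.pi * Real.sqrt 3 / 4) * ((m : ℝ) / (2 * (n : ℝ) + 1)) := by
  set C : ℝ := (Real.pi * Real.sqrt 3 / 4) * ((m : ℝ) / (2 * (n : ℝ) + 1)) with hC
  have hC0 : 0 ≤ C := by positivity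
  have hξ₀' (k : Fin q) : ξ₀ k = cyclicTent n q k := hξ₀ k
  have key : ‖ξ₀ - Matrix.toEuclideanLin y ξ₀‖ ≤ C * ‖ξ₀‖ := by
    refine le_of_sq_le_sq ?_ (by positivity)
    rw [mul_pow, EuclideanSpace.norm_sq_eq, EuclideanSpace.norm_sq_eq]
    have hcoord (k : Fin q) : ‖(ξ₀ - Matrix.toEuclideanLin y ξ₀) k‖ ^ 2
        = ‖cyclicTent n q k‖ ^ 2 * ‖1 - ζ ^ ((k : ℕ) * m)‖ ^ 2 := by
      rw [← mul_pow, ← norm_mul, ← hξ₀']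
      congr 2
      simp [hy, Matrix.toLpLin_apply, Matrix.mulVec_diagonal]
      ring
    simp_rw [hcoord, hξ₀']
    rw [Fin.sum_univ_eq_sum_range
        (fun k => ‖cyclicTent n q k‖ ^ 2 * ‖1 - ζ ^ (k * m)‖ ^ 2) q,
      Fin.sum_univ_eq_sum_range (fun k => ‖cyclicTent n q k‖ ^ 2) q, hζ]
    exact sum_cyclicTent_mul_norm_one_sub_pow_le n m q hq
  rw [hξ, map_smul, ← smul_sub, norm_smul, norm_inv, Complex.norm_real, norm_norm]
  exact inv_mul_le_of_le_mul₀ (norm_nonneg _) hC0 (by rwa [mul_comm])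
end
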